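/- arXiv:0910.3325 — 4 statements merged into one kernel-verified Lean document; each statement's English description precedes it below -/
import Mathlib

section
/- Let Λ be a finite set, let t ∈ ℝ^Λ, let ε_j ≥ 0 for j ∈ Λ, and let D be a real symmetric positive definite Λ×Λ matrix whose quadratic form satisfies f·Df ≥ Σ_{j∈Λ} ε_j e^{−t_j} f_j² for all f ∈ ℝ^Λ. Then for any x, y ∈ Λ with ε_x > 0 and ε_y > 0, the inverse matrix satisfies (D^{-1})_{xy} ≤ e^{t_x}/ε_x + e^{t_y}/ε_y. -/
open Finset Matrix

/-- If the quadratic form of `D` dominates `c f_x²` with `c > 0`, then `(D⁻¹)_{xx} ≤ 1/c`. -/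
theorem Matrix.inv_diag_le_inv {Λ : Type*} [Fintype Λ] [DecidableEq Λ]
    {D : Matrix Λ Λ ℝ} (hD : IsUnit D.det) {c : ℝ} (hc : 0 < c) (x : Λ)
    (h : ∀ f : Λ → ℝ, c * f x ^ 2 ≤ f ⬝ᵥ D.mulVec f) :
    D⁻¹ x x ≤ c⁻¹ := by
  have key := h (D⁻¹.col x)
  rw [← mulVec_single_one, mulVec_mulVec, mul_nonsing_inv _ hD, one_mulVec,
    dotProduct_single_one, mulVec_single_one, col_apply] at key
  by_contra! hlt
  have h1 : 1 < c * D⁻¹ x x := by rwa [inv_lt_iff_one_lt_mul₀' hc] at hlt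
  nlinarith [(inv_pos.mpr hc).trans hlt]

/-- An off-diagonal entry of a real positive semidefinite matrix is at most the mean of the
corresponding diagonal entries. -/
theorem Matrix.PosSemidef.two_mul_apply_le {Λ : Type*} [Fintype Λ] [DecidableEq Λ]
    {A : Matrix Λ Λ ℝ} (hA : A.PosSemidef) (x y : Λ) :
    2 * A x y ≤ A x x + A y y := by
  have h := hA.dotProduct_mulVec_nonneg (Pi.single x 1 - Pi.single y 1)
  have hsymm : A y x = A x y := by simpa using hA.isHermitian.apply x y
  simp only [star_trivial, mulVec_sub, mulVec_single_one, sub_dotProduct, dotProduct_sub,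
    single_one_dotProduct, col_apply] at h
  linarith

/-- If `D` is a real symmetric positive definite `Λ×Λ` matrix whose quadratic form
dominates `Σ_j ε_j e^{-t_j} f_j²`, then for `x, y` with `ε_x > 0`, `ε_y > 0` one has
`(D⁻¹)_{xy} ≤ e^{t_x}/ε_x + e^{t_y}/ε_y`. -/
theorem inverse_entry_bound {Λ : Type*} [Fintype Λ] [DecidableEq Λ]
    (D : Matrix Λ Λ ℝ) (hD : D.PosDef)
    (t ε : Λ → ℝ) (hε : ∀ j, 0 ≤ ε j)
    (hquad : ∀ f : Λ → ℝ,
      ∑ j, ε j * Real.exp (-t j) * f j ^ 2 ≤ f ⬝ᵥ D.mulVec f)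
    (x y : Λ) (hεx : 0 < ε x) (hεy : 0 < ε y) :
    D⁻¹ x y ≤ Real.exp (t x) / ε x + Real.exp (t y) / ε y := by
  have diag (z : Λ) (hz : 0 < ε z) : D⁻¹ z z ≤ Real.exp (t z) / ε z := by
    have hc : 0 < ε z * Real.exp (-t z) := by positivity
    refine (inv_diag_le_inv ((isUnit_iff_isUnit_det D).mp hD.isUnit) hc z fun f =>
      le_trans ?_ (hquad f)).trans_eq ?_
    · exact single_le_sum (f := fun j => ε j * Real.exp (-t j) * f j ^ 2)
        (fun j _ => mul_nonneg (mul_nonneg (hε j) (Real.exp_pos _).le) (sq_nonneg _)) (mem_univ z)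
    · rw [Real.exp_neg, mul_inv, inv_inv, div_eq_inv_mul]
  have hoff := hD.inv.posSemidef.two_mul_apply_le x y
  have hx : 0 < Real.exp (t x) / ε x := by positivity
  have hy : 0 < Real.exp (t y) / ε y := by positivity
  linarith [diag x hεx, diag y hεy]
end

section
/- Let Λ be a finite set, let M be an invertible Λ×Λ matrix with real entries, and let x, y ∈ Λ with x ≠ y. Then (M^{-1})_{xy} · det M = Σ over all finite sequences γ = (j_0, j_1, …, j_m, j_{m+1}) of pairwise distinct elements of Λ with j_0 = x and j_{m+1} = y (m ≥ 0) of the product [Π_{i=0}^{m} (−M_{j_i j_{i+1}})] · det(M restricted to Λ ∖ {j_0, …, j_{m+1}}), where for S ⊂ Λ, 'M restricted to S' is the submatrix of M with rows and columns indexed by S, and the determinant of the empty matrix is 1. -/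
open Finset Matrix

section PathExpansion

variable {Λ R : Type*} [Fintype Λ] [DecidableEq Λ] [CommRing R]

/-- The matrix `M` with the rows indexed by `S` replaced by those of the identity. -/
def Matrix.replaceRowsByOne (M : Matrix Λ Λ R) (S : Finset Λ) : Matrix Λ Λ R :=
  Matrix.of fun i => if i ∈ S then Pi.single i 1 else M i

/-- The sum over self-avoiding paths with `m` steps from `x` to `y` which avoid `S`, weighted by
the negated matrix entries and the determinant of `M` on the complement of `S` and the path. -/
def Matrix.pathSum (M : Matrix Λ Λ R) (y : Λ) (m : ℕ) (S : Finset Λ) (x : Λ) : R :=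
  ∑ f : Fin (m + 1) → Λ,
    if Function.Injective f ∧ (∀ i, f i ∉ S) ∧ f 0 = x ∧ f (Fin.last m) = y then
      (∏ i : Fin m, -M (f i.castSucc) (f i.succ)) *
        (M.replaceRowsByOne (S ∪ Finset.image f Finset.univ)).det
    else 0

theorem Matrix.det_replaceRowsByOne (M : Matrix Λ Λ R) (S : Finset Λ) :
    (M.replaceRowsByOne S).det =
      (M.submatrix (fun z : {z : Λ // z ∉ S} => z.1) (fun z : {z : Λ // z ∉ S} => z.1)).det := by
  rw [Matrix.twoBlockTriangular_det (M.replaceRowsByOne S) (· ∉ S)]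
  · have h1 : (M.replaceRowsByOne S).toSquareBlockProp (fun i => ¬ i ∉ S) = 1 := by
      ext i j
      have hi : (i : Λ) ∈ S := not_not.1 i.2
      rw [toSquareBlockProp_def, of_apply, replaceRowsByOne, of_apply, if_pos hi,
        Pi.single_apply, Matrix.one_apply]
      exact if_congr (by rw [Subtype.ext_iff, eq_comm]) rfl rfl
    have h2 : (M.replaceRowsByOne S).toSquareBlockProp (· ∉ S) =
        M.submatrix (fun z : {z : Λ // z ∉ S} => z.1) (fun z : {z : Λ // z ∉ S} => z.1) := by
      ext i j
      rw [toSquareBlockProp_def, of_apply, replaceRowsByOne, of_apply, if_neg i.2,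
        submatrix_apply]
    rw [h1, h2, det_one, mul_one]
  · intro i hi j hj
    have hji : j ≠ i := fun h => hj (h ▸ not_not.1 hi)
    simp [replaceRowsByOne, not_not.1 hi, hji]

theorem Matrix.adjugate_replaceRowsByOne_of_mem (M : Matrix Λ Λ R) {S : Finset Λ} {x y : Λ}
    (hx : x ∈ S) (hy : y ∉ S) : (M.replaceRowsByOne S).adjugate x y = 0 := by
  have hxy : x ≠ y := fun h => hy (h ▸ hx)
  rw [adjugate_apply]
  refine det_zero_of_row_eq hxy ?_
  rw [updateRow_ne hxy, updateRow_self]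
  exact if_pos hx

theorem Matrix.adjugate_replaceRowsByOne_self (M : Matrix Λ Λ R) (S : Finset Λ) (y : Λ) :
    (M.replaceRowsByOne S).adjugate y y = (M.replaceRowsByOne (insert y S)).det := by
  rw [adjugate_apply]
  congr 1
  ext i j
  by_cases h : i = y
  · subst h; simp [replaceRowsByOne]
  · simp [replaceRowsByOne, h]

theorem Matrix.adjugate_replaceRowsByOne_of_ne (M : Matrix Λ Λ R) {S : Finset Λ} {x y : Λ}
    (hx : x ∉ S) (hxy : x ≠ y) :
    (M.replaceRowsByOne S).adjugate x y =
      ∑ z, -M x z * (M.replaceRowsByOne (insert x S)).adjugate z y := by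
  rw [adjugate_apply, det_eq_sum_mul_adjugate_row _ x]
  refine Finset.sum_congr rfl fun z _ => ?_
  have hxz : (M.replaceRowsByOne S).updateRow y (Pi.single x 1) x z = M x z := by
    rw [updateRow_ne hxy]
    simp [replaceRowsByOne, hx]
  have hswap : (M.replaceRowsByOne (insert x S)).updateRow y (Pi.single z 1) =
      (((M.replaceRowsByOne S).updateRow y (Pi.single x 1)).updateRow x
        (Pi.single z 1)).submatrix (Equiv.swap x y) id := by
    ext i j
    by_cases hix : i = x
    · subst hix
      simp [replaceRowsByOne, updateRow_ne hxy, updateRow_ne hxy.symm]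
    by_cases hiy : i = y
    · subst hiy
      simp
    · simp [replaceRowsByOne, Equiv.swap_apply_of_ne_of_ne hix hiy,
        updateRow_ne hiy, hix]
  rw [hxz, adjugate_apply, adjugate_apply, hswap, det_permute, Equiv.Perm.sign_swap hxy]
  simp

theorem Matrix.pathSum_of_mem (M : Matrix Λ Λ R) (y : Λ) (m : ℕ) {S : Finset Λ} {x : Λ}
    (hx : x ∈ S) : M.pathSum y m S x = 0 := by
  refine Finset.sum_eq_zero fun f _ => if_neg ?_
  rintro ⟨-, h, h0, -⟩
  exact h 0 (h0 ▸ hx)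

theorem Matrix.pathSum_zero_self (M : Matrix Λ Λ R) {S : Finset Λ} {y : Λ} (hy : y ∉ S) :
    M.pathSum y 0 S y = (M.replaceRowsByOne (insert y S)).det := by
  rw [pathSum, Finset.sum_eq_single (fun _ => y)]
  · rw [if_pos ⟨fun i j _ => (Fin.subsingleton_one.elim i j), fun _ => hy, rfl, rfl⟩]
    have : S ∪ Finset.image (fun _ : Fin (0 + 1) => y) Finset.univ = insert y S := by
      ext; simp
    rw [this]
    simp
  · intro f _ hf
    refine if_neg ?_
    rintro ⟨-, -, h0, -⟩
    exact hf (funext fun i => by rw [Fin.subsingleton_one.elim i 0, h0])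
  · simp

theorem Matrix.pathSum_zero_of_ne (M : Matrix Λ Λ R) (S : Finset Λ) {x y : Λ} (hxy : x ≠ y) :
    M.pathSum y 0 S x = 0 := by
  refine Finset.sum_eq_zero fun f _ => if_neg ?_
  rintro ⟨-, -, h0, h1⟩
  exact hxy (h0.symm.trans h1)

theorem Matrix.pathSum_succ_self (M : Matrix Λ Λ R) (m : ℕ) (S : Finset Λ) (y : Λ) :
    M.pathSum y (m + 1) S y = 0 := by
  refine Finset.sum_eq_zero fun f _ => if_neg ?_
  rintro ⟨hf, -, h0, h1⟩
  exact (Fin.last_pos (n := m)).ne (hf (h0.trans h1.symm))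

theorem Matrix.pathSum_succ (M : Matrix Λ Λ R) (y : Λ) (m : ℕ) {S : Finset Λ} {x : Λ}
    (hx : x ∉ S) :
    M.pathSum y (m + 1) S x = ∑ z, -M x z * M.pathSum y m (insert x S) z := by
  simp only [pathSum, Finset.mul_sum]
  rw [Finset.sum_comm, ← (Fin.consEquiv fun _ => Λ).sum_comp, Fintype.sum_prod_type_right]
  refine Finset.sum_congr rfl fun g _ => ?_
  rw [Finset.sum_eq_single x, Finset.sum_eq_single (g 0)]
  · have hiff : (Function.Injective (Fin.cons x g : Fin (m + 2) → Λ) ∧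
        (∀ i, (Fin.cons x g : Fin (m + 2) → Λ) i ∉ S) ∧
        (Fin.cons x g : Fin (m + 2) → Λ) 0 = x ∧
        (Fin.cons x g : Fin (m + 2) → Λ) (Fin.last (m + 1)) = y) ↔
        (Function.Injective g ∧ (∀ i, g i ∉ insert x S) ∧ g 0 = g 0 ∧ g (Fin.last m) = y) := by
      rw [Fin.cons_injective_iff, ← Fin.succ_last]
      simp only [Fin.forall_fin_succ (n := m + 1), Fin.cons_zero, Fin.cons_succ, Set.mem_range,
        Finset.mem_insert, not_or, forall_and, not_exists]
      tauto
    have himage : S ∪ Finset.image (Fin.cons x g : Fin (m + 2) → Λ) Finset.univ =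
        insert x S ∪ Finset.image g Finset.univ := by
      ext a
      simp [Fin.exists_fin_succ (n := m + 1), eq_comm]
      tauto
    simp only [Fin.consEquiv, Equiv.coe_fn_mk]
    simp only [hiff, himage]
    rw [mul_ite, mul_zero]
    congr 1
    rw [Fin.prod_univ_succ, mul_assoc]
    simp
  · intro z _ hz
    rw [if_neg fun h => hz h.2.2.1.symm, mul_zero]
  · simp
  · intro a _ ha
    exact if_neg fun h => ha h.2.2.1
  · simp

theorem Matrix.adjugate_replaceRowsByOne_eq_sum_pathSum (M : Matrix Λ Λ R) (y : Λ) (k : ℕ)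
    {S : Finset Λ} (hy : y ∉ S) (hS : Sᶜ.card ≤ k) (x : Λ) :
    (M.replaceRowsByOne S).adjugate x y = ∑ m ∈ Finset.range k, M.pathSum y m S x := by
  induction k generalizing S x with
  | zero =>
    have := Finset.card_eq_zero.1 (Nat.le_zero.1 hS)
    simp_all
  | succ k ih =>
    by_cases hx : x ∈ S
    · rw [adjugate_replaceRowsByOne_of_mem M hx hy]
      exact (Finset.sum_eq_zero fun m _ => pathSum_of_mem M y m hx).symm
    rw [Finset.sum_range_succ']
    by_cases hxy : x = y
    · subst hxy
      simp [adjugate_replaceRowsByOne_self, pathSum_zero_self M hy, pathSum_succ_self]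
    rw [pathSum_zero_of_ne M S hxy, add_zero, adjugate_replaceRowsByOne_of_ne M hx hxy]
    simp only [pathSum_succ M y _ hx]
    rw [Finset.sum_comm]
    refine Finset.sum_congr rfl fun z _ => ?_
    rw [← Finset.mul_sum, ih]
    · simpa [hy] using Ne.symm hxy
    · rw [Finset.compl_insert, Finset.card_erase_of_mem (by simpa using hx)]
      omega

end PathExpansion

/-- Path (cycle-decomposition) expansion of a cofactor: for an invertible matrix `M`
and `x ≠ y`,
`(M⁻¹)_{xy} · det M` equals the sum over all finite sequences
`(j_0 = x, j_1, …, j_m, j_{m+1} = y)` of pairwise distinct indices of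
`(∏_{i=0}^{m} (-M_{j_i j_{i+1}})) · det(M restricted to the complement of the path)`.
(The empty determinant is `1`; terms with paths longer than `card Λ` vanish since
no injective sequence exists.) -/
theorem cofactor_path_expansion {Λ : Type*} [Fintype Λ] [DecidableEq Λ]
    (M : Matrix Λ Λ ℝ) (hM : IsUnit M.det) (x y : Λ) (hxy : x ≠ y) :
    M⁻¹ x y * M.det
      = ∑ m ∈ Finset.range (Fintype.card Λ),
          ∑ f ∈ Finset.univ.filter (fun f : Fin (m + 2) → Λ =>
              Function.Injective f ∧ f 0 = x ∧ f (Fin.last (m + 1)) = y),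
            (∏ i : Fin (m + 1), -M (f i.castSucc) (f i.succ)) *
              (M.submatrix
                (fun z : {z : Λ // z ∉ Finset.image f Finset.univ} => z.1)
                (fun z : {z : Λ // z ∉ Finset.image f Finset.univ} => z.1)).det := by
  have hinv : M⁻¹ x y * M.det = M.adjugate x y := by
    rw [Matrix.inv_def, Matrix.smul_apply, smul_eq_mul, mul_right_comm,
      Ring.inverse_mul_cancel _ hM, one_mul]
  have hempty : M.replaceRowsByOne ∅ = M := by
    ext i j
    simp [replaceRowsByOne]
  have key := M.adjugate_replaceRowsByOne_eq_sum_pathSum y (Fintype.card Λ + 1)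
    (Finset.notMem_empty y) (by simp) x
  rw [hempty, Finset.sum_range_succ', pathSum_zero_of_ne M ∅ hxy, add_zero] at key
  rw [hinv, key]
  refine Finset.sum_congr rfl fun m _ => ?_
  rw [Finset.sum_filter, pathSum]
  refine Finset.sum_congr rfl fun f _ => ?_
  simp [det_replaceRowsByOne]
end

section
/- For every t ∈ ℝ^Λ and every f ∈ ℝ^Λ one has the exact identity f·D^ε_Λ(t)f = β Σ_{(jj')} e^{t_j + t_{j'}} (e^{−t_j} f_j − e^{−t_{j'}} f_{j'})² + β Σ_{j∈Λ} (2d − deg_Λ(j)) f_j² + Σ_{j∈Λ} ε_j e^{−t_j} f_j², where deg_Λ(j) = #{k ∈ Λ : |k−j| = 1}. In particular f·D^ε_Λ(t)f ≥ Σ_{j∈Λ} ε_j e^{−t_j} f_j² for all f ∈ ℝ^Λ, and if Λ is connected (as a nearest-neighbor graph) and ε_j > 0 for at least one j, then D^ε_Λ(t) is positive definite. -/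
open Real MeasureTheory Finset Matrix

noncomputable section

/-- Squared Euclidean distance between two points of `ℤ^d`;
`eSq j k = 1` means `j` and `k` are nearest neighbours. -/
def eSq {d : ℕ} (j k : Fin d → ℤ) : ℤ := ∑ i, (j i - k i) ^ 2

/-- Euclidean (lattice) distance between two points of `ℤ^d`. -/
def latDist {d : ℕ} (x y : Fin d → ℤ) : ℝ :=
  Real.sqrt (∑ i, ((x i : ℝ) - (y i : ℝ)) ^ 2)

/-- Kinetic term `F_Λ(∇t) = β Σ_{(jj')} (cosh(t_j - t_{j'}) - 1)`;
each unordered nearest-neighbour pair of `Λ` is counted once. -/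
def Fkin {d : ℕ} (Λ : Finset (Fin d → ℤ)) (β : ℝ) (t : (Fin d → ℤ) → ℝ) : ℝ :=
  β / 2 * ∑ j ∈ Λ, ∑ k ∈ Λ.filter (fun k => eSq j k = 1), (Real.cosh (t j - t k) - 1)

/-- Mass term `M^ε_Λ(t) = Σ_j ε_j (cosh t_j - 1)`. -/
def Mmass {d : ℕ} (Λ : Finset (Fin d → ℤ)) (ε : (Fin d → ℤ) → ℝ)
    (t : (Fin d → ℤ) → ℝ) : ℝ :=
  ∑ j ∈ Λ, ε j * (Real.cosh (t j) - 1)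

/-- `V_j = Σ_{k ∈ Λ, |k-j|=1} (e^{t_k - t_j} - 1)`. -/
def Vpot {d : ℕ} (Λ : Finset (Fin d → ℤ)) (t : (Fin d → ℤ) → ℝ) (j : Fin d → ℤ) : ℝ :=
  ∑ k ∈ Λ.filter (fun k => eSq j k = 1), (Real.exp (t k - t j) - 1)

/-- The matrix `D^ε_Λ(t)`:  `D_{ij} = 0` if `|i-j| > 1`, `D_{ij} = -β` if `|i-j| = 1`,
`D_{jj} = β(2d + V_j) + ε_j e^{-t_j}`. -/
def Dmat {d : ℕ} (Λ : Finset (Fin d → ℤ)) (β : ℝ) (ε : (Fin d → ℤ) → ℝ)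
    (t : (Fin d → ℤ) → ℝ) : Matrix {z // z ∈ Λ} {z // z ∈ Λ} ℝ := fun i j =>
  if eSq i.1 j.1 = 1 then -β
  else if i = j then β * (2 * (d : ℝ) + Vpot Λ t j.1) + ε j.1 * Real.exp (-t j.1)
  else 0

/-- Extension of a configuration `t ∈ ℝ^Λ` by `0` outside `Λ`
(the model only ever uses the values on `Λ`). -/
def extend0 {d : ℕ} (Λ : Finset (Fin d → ℤ)) (t : {z // z ∈ Λ} → ℝ) :
    (Fin d → ℤ) → ℝ :=
  fun z => if h : z ∈ Λ then t ⟨z, h⟩ else 0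

/-- Density of the measure `dμ^ε_Λ` with respect to Lebesgue measure on `ℝ^Λ`:
`Π_j (1/√(2π)) · e^{-F_Λ(∇t)} · e^{-M^ε_Λ(t)} · √(det D^ε_Λ(t))`. -/
def dens {d : ℕ} (Λ : Finset (Fin d → ℤ)) (β : ℝ) (ε : (Fin d → ℤ) → ℝ)
    (t : {z // z ∈ Λ} → ℝ) : ℝ :=
  (Real.sqrt (2 * π))⁻¹ ^ Λ.card * Real.exp (-Fkin Λ β (extend0 Λ t)) *
    Real.exp (-Mmass Λ ε (extend0 Λ t)) *
    Real.sqrt (Dmat Λ β ε (extend0 Λ t)).det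

/-- The one-site integral `I_β = √(β/(2π)) ∫_ℝ e^{-β(cosh t - 1)} dt`. -/
def Ibeta (β : ℝ) : ℝ :=
  Real.sqrt (β / (2 * π)) * ∫ t : ℝ, Real.exp (-β * (Real.cosh t - 1))

/-- `Λ` is connected as a nearest-neighbour graph. -/
def latticeConn {d : ℕ} (Λ : Finset (Fin d → ℤ)) : Prop :=
  ∀ x ∈ Λ, ∀ y ∈ Λ,
    Relation.ReflTransGen (fun a b => a ∈ Λ ∧ b ∈ Λ ∧ eSq a b = 1) x y

lemma eSq_comm {d : ℕ} (j k : Fin d → ℤ) : eSq j k = eSq k j :=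
  Finset.sum_congr rfl fun _ _ => by ring

lemma eSq_self {d : ℕ} (j : Fin d → ℤ) : eSq j j = 0 := by simp [eSq]

/-- A nearest neighbour of `j` is of the form `j ± e_i`. -/
lemma exists_eq_add_single_of_eSq_eq_one {d : ℕ} {j k : Fin d → ℤ} (h : eSq j k = 1) :
    ∃ (i : Fin d) (u : ℤˣ), k = j + Pi.single i (u : ℤ) := by
  have hne : ∃ i, j i - k i ≠ 0 := by
    by_contra! h0
    simp [eSq, h0] at h
  obtain ⟨i, hi⟩ := hne
  have hsum : (j i - k i) ^ 2 + ∑ l ∈ Finset.univ.erase i, (j l - k l) ^ 2 = 1 :=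
    (Finset.add_sum_erase Finset.univ (fun i => (j i - k i) ^ 2) (Finset.mem_univ i)).trans h
  have hpos : 0 < (j i - k i) ^ 2 := by positivity
  have hnn : 0 ≤ ∑ l ∈ Finset.univ.erase i, (j l - k l) ^ 2 :=
    Finset.sum_nonneg fun l _ => sq_nonneg _
  have hrest : ∑ l ∈ Finset.univ.erase i, (j l - k l) ^ 2 = 0 := by lia
  have hone : (k i - j i) ^ 2 = 1 := by linear_combination hsum - hrest
  rw [Finset.sum_eq_zero_iff_of_nonneg fun l _ => sq_nonneg _] at hrest
  obtain ⟨u, hu⟩ : IsUnit (k i - j i) := IsUnit.of_mul_eq_one _ (by rw [← sq, hone])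
  refine ⟨i, u, funext fun l => ?_⟩
  obtain rfl | hl := eq_or_ne l i
  · simp [hu]
  · have := pow_eq_zero_iff two_ne_zero |>.1 (hrest l (by simp [hl]))
    simp only [Pi.add_apply, Pi.single_eq_of_ne hl]
    lia

lemma card_neighbours_le {d : ℕ} (Λ : Finset (Fin d → ℤ)) (j : Fin d → ℤ) :
    (Λ.filter (fun k => eSq j k = 1)).card ≤ 2 * d := by
  have hsub : Λ.filter (fun k => eSq j k = 1) ⊆
      (Finset.univ : Finset (Fin d × ℤˣ)).image fun p => j + Pi.single p.1 (p.2 : ℤ) := by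
    intro k hk
    obtain ⟨i, u, rfl⟩ := exists_eq_add_single_of_eSq_eq_one (Finset.mem_filter.1 hk).2
    exact Finset.mem_image_of_mem _ (Finset.mem_univ (i, u))
  refine (Finset.card_le_card hsub).trans (Finset.card_image_le.trans ?_)
  simp [mul_comm]

lemma sum_neighbours_eq {d : ℕ} (Λ : Finset (Fin d → ℤ)) (j : Fin d → ℤ)
    (g : (Fin d → ℤ) → ℝ) :
    ∑ k ∈ Λ.filter (fun k => eSq j k = 1), g k =
      ∑ k : {z // z ∈ Λ}, if eSq j k.1 = 1 then g k.1 else 0 := by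
  rw [Finset.sum_filter]
  exact (Finset.sum_coe_sort Λ fun k => if eSq j k = 1 then g k else 0).symm

lemma exp_add_mul_sq_sub (a b x y : ℝ) :
    Real.exp (a + b) * (Real.exp (-a) * x - Real.exp (-b) * y) ^ 2 =
      Real.exp (b - a) * x ^ 2 + Real.exp (a - b) * y ^ 2 - 2 * (x * y) := by
  simp only [Real.exp_add, Real.exp_sub, Real.exp_neg]
  field_simp
  ring

lemma Dmat_isHermitian {d : ℕ} (Λ : Finset (Fin d → ℤ)) (β : ℝ)
    (ε t : (Fin d → ℤ) → ℝ) : (Dmat Λ β ε t).IsHermitian := by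
  ext i j
  simp only [Matrix.conjTranspose_apply, star_trivial, Dmat, eSq_comm j.1 i.1]
  obtain rfl | hij := eq_or_ne i j
  · rfl
  · simp [hij, hij.symm]

lemma dotProduct_Dmat_mulVec {d : ℕ} (Λ : Finset (Fin d → ℤ)) (β : ℝ)
    (ε t : (Fin d → ℤ) → ℝ) (f : {z // z ∈ Λ} → ℝ) :
    f ⬝ᵥ (Dmat Λ β ε t).mulVec f
      = β / 2 * ∑ j : {z // z ∈ Λ},
            ∑ k ∈ Finset.univ.filter (fun k : {z // z ∈ Λ} => eSq j.1 k.1 = 1),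
              Real.exp (t j.1 + t k.1) *
                (Real.exp (-t j.1) * f j - Real.exp (-t k.1) * f k) ^ 2
        + β * ∑ j : {z // z ∈ Λ},
            (2 * (d : ℝ) - ((Λ.filter (fun k => eSq j.1 k = 1)).card : ℝ)) * f j ^ 2
        + ∑ j : {z // z ∈ Λ}, ε j.1 * Real.exp (-t j.1) * f j ^ 2 := by
  let A (j k : {z // z ∈ Λ}) : ℝ := if eSq j.1 k.1 = 1 then 1 else 0
  let S : ℝ := ∑ j, ∑ k, A j k * (f j * f k)
  let T : ℝ := ∑ j, ∑ k, A j k * (Real.exp (t k.1 - t j.1) * f j ^ 2)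
  have hswap : ∑ j, ∑ k, A j k * (Real.exp (t j.1 - t k.1) * f k ^ 2) = T := by
    rw [Finset.sum_comm]
    simp only [T, A, eSq_comm]
  have hgrad : ∑ j : {z // z ∈ Λ},
      ∑ k ∈ Finset.univ.filter (fun k : {z // z ∈ Λ} => eSq j.1 k.1 = 1),
        Real.exp (t j.1 + t k.1) *
          (Real.exp (-t j.1) * f j - Real.exp (-t k.1) * f k) ^ 2 = 2 * T - 2 * S := by
    have : 2 * T - 2 * S = T + T - 2 * S := by ring
    rw [this]
    nth_rewrite 2 [← hswap]
    simp only [S, T, Finset.mul_sum, ← Finset.sum_add_distrib, ← Finset.sum_sub_distrib,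
      Finset.sum_filter]
    refine Finset.sum_congr rfl fun j _ => Finset.sum_congr rfl fun k _ => ?_
    simp only [A, exp_add_mul_sq_sub]
    split_ifs <;> ring
  have hV (j : {z // z ∈ Λ}) : Vpot Λ t j.1 * f j ^ 2 =
      ∑ k, A j k * (Real.exp (t k.1 - t j.1) * f j ^ 2)
        - ((Λ.filter (fun k => eSq j.1 k = 1)).card : ℝ) * f j ^ 2 := by
    rw [Vpot, Finset.sum_sub_distrib, sum_neighbours_eq Λ j.1 fun k => Real.exp (t k - t j.1),
      sub_mul, Finset.sum_mul]
    simp [A, ite_mul]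
  have hrow (j : {z // z ∈ Λ}) : f j * (Dmat Λ β ε t).mulVec f j =
      -β * ∑ k, A j k * (f j * f k)
        + (β * (2 * (d : ℝ) + Vpot Λ t j.1) + ε j.1 * Real.exp (-t j.1)) * f j ^ 2 := by
    have hdiag : (β * (2 * (d : ℝ) + Vpot Λ t j.1) + ε j.1 * Real.exp (-t j.1)) * f j ^ 2 =
        ∑ k, if j = k then
          (β * (2 * (d : ℝ) + Vpot Λ t k.1) + ε k.1 * Real.exp (-t k.1)) * f k ^ 2 else 0 := by
      simp
    rw [hdiag, Matrix.mulVec, dotProduct, Finset.mul_sum, Finset.mul_sum,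
      ← Finset.sum_add_distrib]
    refine Finset.sum_congr rfl fun k _ => ?_
    obtain rfl | hjk := eq_or_ne j k
    · simp [Dmat, A, eSq_self]
      ring
    · simp only [Dmat, A, hjk, if_false]
      split_ifs <;> ring
  have hsum : f ⬝ᵥ (Dmat Λ β ε t).mulVec f =
      ∑ j : {z // z ∈ Λ}, (-β * ∑ k, A j k * (f j * f k)
        + β * ∑ k, A j k * (Real.exp (t k.1 - t j.1) * f j ^ 2)
        + β * ((2 * (d : ℝ) - ((Λ.filter (fun k => eSq j.1 k = 1)).card : ℝ)) * f j ^ 2)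
        + ε j.1 * Real.exp (-t j.1) * f j ^ 2) := by
    refine Finset.sum_congr rfl fun j _ => ?_
    rw [hrow]
    linear_combination β * hV j
  rw [hsum, hgrad]
  simp only [Finset.sum_add_distrib, ← Finset.mul_sum]
  ring

lemma weighted_gradient_nonneg {ι : Type*} (s : Finset ι) (a b : ι → ℝ) :
    0 ≤ ∑ k ∈ s, Real.exp (a k) * b k ^ 2 :=
  Finset.sum_nonneg fun _ _ => by positivity

lemma boundary_term_nonneg {d : ℕ} (Λ : Finset (Fin d → ℤ)) (f : {z // z ∈ Λ} → ℝ) :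
    0 ≤ ∑ j : {z // z ∈ Λ},
      (2 * (d : ℝ) - ((Λ.filter (fun k => eSq j.1 k = 1)).card : ℝ)) * f j ^ 2 := by
  refine Finset.sum_nonneg fun j _ => mul_nonneg (sub_nonneg.2 ?_) (sq_nonneg _)
  exact_mod_cast card_neighbours_le Λ j.1

/-- A function on a connected `Λ` that vanishes at one point and satisfies
`e^{-t_j} f_j = e^{-t_k} f_k` along edges vanishes identically. -/
lemma eq_zero_of_latticeConn {d : ℕ} {Λ : Finset (Fin d → ℤ)} (hΛ : latticeConn Λ)
    {t : (Fin d → ℤ) → ℝ} {f : {z // z ∈ Λ} → ℝ}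
    (hedge : ∀ j k : {z // z ∈ Λ}, eSq j.1 k.1 = 1 →
      Real.exp (-t j.1) * f j = Real.exp (-t k.1) * f k)
    {j₀ : {z // z ∈ Λ}} (h₀ : f j₀ = 0) : f = 0 := by
  have hpath : ∀ y, Relation.ReflTransGen
      (fun a b => a ∈ Λ ∧ b ∈ Λ ∧ eSq a b = 1) j₀.1 y → ∀ hy : y ∈ Λ, f ⟨y, hy⟩ = 0 := by
    intro y h
    induction h with
    | refl => exact fun _ => h₀
    | tail _ hbc ih =>
      intro hc
      have := hedge ⟨_, hbc.1⟩ ⟨_, hc⟩ hbc.2.2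
      rw [ih hbc.1, mul_zero, eq_comm, mul_eq_zero] at this
      exact this.resolve_left (Real.exp_ne_zero _)
  exact funext fun k => hpath k.1 (hΛ _ j₀.2 _ k.2) k.2

/-- Exact quadratic-form identity for `D^ε_Λ(t)`:
`f·Df = (β/2) Σ_j Σ_{k~j} e^{t_j+t_k}(e^{-t_j}f_j - e^{-t_k}f_k)²
      + β Σ_j (2d - deg_Λ(j)) f_j² + Σ_j ε_j e^{-t_j} f_j²`
(each unordered nearest-neighbour pair contributes once, whence the `β/2` in the
double sum); in particular `f·Df ≥ Σ_j ε_j e^{-t_j} f_j²`, and if `Λ` is connected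
and some `ε_j > 0` then `D^ε_Λ(t)` is positive definite. -/
theorem quadratic_form_identity
    (d : ℕ) (hd : 1 ≤ d) (β : ℝ) (hβ : 0 < β)
    (Λ : Finset (Fin d → ℤ)) (ε : (Fin d → ℤ) → ℝ) (hε : ∀ j, 0 ≤ ε j)
    (t : (Fin d → ℤ) → ℝ) :
    (∀ f : {z // z ∈ Λ} → ℝ,
        f ⬝ᵥ (Dmat Λ β ε t).mulVec f
          = β / 2 * ∑ j : {z // z ∈ Λ},
                ∑ k ∈ Finset.univ.filter (fun k : {z // z ∈ Λ} => eSq j.1 k.1 = 1),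
                  Real.exp (t j.1 + t k.1) *
                    (Real.exp (-t j.1) * f j - Real.exp (-t k.1) * f k) ^ 2
            + β * ∑ j : {z // z ∈ Λ},
                (2 * (d : ℝ) - ((Λ.filter (fun k => eSq j.1 k = 1)).card : ℝ)) * f j ^ 2
            + ∑ j : {z // z ∈ Λ}, ε j.1 * Real.exp (-t j.1) * f j ^ 2) ∧
      (∀ f : {z // z ∈ Λ} → ℝ,
        ∑ j : {z // z ∈ Λ}, ε j.1 * Real.exp (-t j.1) * f j ^ 2
          ≤ f ⬝ᵥ (Dmat Λ β ε t).mulVec f) ∧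
      (latticeConn Λ → (∃ j ∈ Λ, 0 < ε j) → (Dmat Λ β ε t).PosDef) := by
  have hgrad (f : {z // z ∈ Λ} → ℝ) (j : {z // z ∈ Λ}) := weighted_gradient_nonneg
    (Finset.univ.filter fun k : {z // z ∈ Λ} => eSq j.1 k.1 = 1)
    (fun k => t j.1 + t k.1) (fun k => Real.exp (-t j.1) * f j - Real.exp (-t k.1) * f k)
  have hgrad_sum (f : {z // z ∈ Λ} → ℝ) := Finset.sum_nonneg fun j (_ : j ∈ univ) => hgrad f j
  have hmass (f : {z // z ∈ Λ} → ℝ) (j : {z // z ∈ Λ}) :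
      0 ≤ ε j.1 * Real.exp (-t j.1) * f j ^ 2 :=
    mul_nonneg (mul_nonneg (hε _) (Real.exp_pos _).le) (sq_nonneg _)
  refine ⟨dotProduct_Dmat_mulVec Λ β ε t, fun f => ?_, fun hΛ ⟨j₀, hj₀, hpos⟩ =>
    Matrix.PosDef.of_dotProduct_mulVec_pos (Dmat_isHermitian Λ β ε t) fun f hf => ?_⟩
  · rw [dotProduct_Dmat_mulVec]
    have h₁ := mul_nonneg (half_pos hβ).le (hgrad_sum f)
    have h₂ := mul_nonneg hβ.le (boundary_term_nonneg Λ f)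
    linarith
  · rw [star_trivial, dotProduct_Dmat_mulVec]
    have h₁ := mul_nonneg (half_pos hβ).le (hgrad_sum f)
    have h₂ := mul_nonneg hβ.le (boundary_term_nonneg Λ f)
    have h₃ := Finset.sum_nonneg fun j (_ : j ∈ univ) => hmass f j
    refine lt_of_le_of_ne (by linarith) fun h => hf ?_
    have hG := (mul_eq_zero.1 (le_antisymm (by linarith) h₁)).resolve_left (half_pos hβ).ne'
    have hM := le_antisymm (by linarith) h₃
    rw [Finset.sum_eq_zero_iff_of_nonneg fun j _ => hgrad f j] at hG
    rw [Finset.sum_eq_zero_iff_of_nonneg fun j _ => hmass f j] at hM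
    refine eq_zero_of_latticeConn hΛ (t := t) (j₀ := ⟨j₀, hj₀⟩) (fun j k hjk => ?_) ?_
    · have hj := hG j (mem_univ j)
      rw [Finset.sum_eq_zero_iff_of_nonneg fun k _ => by positivity] at hj
      have hk := hj k (by simp [hjk])
      exact sub_eq_zero.1 (by simpa [Real.exp_ne_zero] using hk)
    · simpa [hpos.ne', Real.exp_ne_zero] using hM ⟨j₀, hj₀⟩ (mem_univ _)

end
end

section
/- For every ε > 0, one has (1/√(2π)) ∫_{−∞}^{∞} e^{t/2} · e^{−ε(cosh t − 1)} dt = 1/√ε. -/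
open Real MeasureTheory

theorem Real.cosh_sub_one_eq_two_mul_sinh_half_sq (t : ℝ) :
    Real.cosh t - 1 = 2 * Real.sinh (t / 2) ^ 2 := by
  have h := Real.cosh_two_mul (t / 2)
  rw [mul_div_cancel₀ t two_ne_zero, Real.cosh_sq] at h
  linarith

theorem Real.hasDerivAt_sinh_half (t : ℝ) :
    HasDerivAt (fun s : ℝ => Real.sinh (s / 2)) (Real.cosh (t / 2) / 2) t := by
  simpa [div_eq_mul_inv] using ((hasDerivAt_id t).div_const 2).sinh

theorem Real.sinh_half_bijective : Function.Bijective fun t : ℝ => Real.sinh (t / 2) := by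
  refine ⟨fun s t h => ?_, fun y => ⟨2 * Real.arsinh y, by simp⟩⟩
  have := Real.sinh_injective h
  linarith

/-- The change of variables `u = sinh (t / 2)` on the real line. -/
theorem integral_cosh_half_mul_comp_sinh_half (g : ℝ → ℝ) :
    ∫ t : ℝ, Real.cosh (t / 2) / 2 * g (Real.sinh (t / 2)) = ∫ u : ℝ, g u := by
  have h := integral_image_eq_integral_abs_deriv_smul MeasurableSet.univ
    (fun t _ => (Real.hasDerivAt_sinh_half t).hasDerivWithinAt)
    Real.sinh_half_bijective.injective.injOn g
  rw [Set.image_univ, Real.sinh_half_bijective.surjective.range_eq] at h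
  simpa [abs_of_pos, Real.cosh_pos] using h.symm

theorem integrable_cosh_half_mul_comp_sinh_half {g : ℝ → ℝ} (hg : Integrable g) :
    Integrable fun t : ℝ => Real.cosh (t / 2) / 2 * g (Real.sinh (t / 2)) := by
  have h := integrableOn_image_iff_integrableOn_abs_deriv_smul MeasurableSet.univ
    (fun t _ => (Real.hasDerivAt_sinh_half t).hasDerivWithinAt)
    Real.sinh_half_bijective.injective.injOn g
  rw [Set.image_univ, Real.sinh_half_bijective.surjective.range_eq, integrableOn_univ,
    integrableOn_univ] at h
  simpa [abs_of_pos, Real.cosh_pos] using h.1 hg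

theorem integrable_cosh_half_mul_exp {ε : ℝ} (hε : 0 < ε) :
    Integrable fun t : ℝ => Real.cosh (t / 2) * Real.exp (-ε * (Real.cosh t - 1)) := by
  have h := (integrable_cosh_half_mul_comp_sinh_half
    (integrable_exp_neg_mul_sq (mul_pos two_pos hε))).const_mul 2
  refine h.congr (.of_forall fun t => ?_)
  simp only [Real.cosh_sub_one_eq_two_mul_sinh_half_sq t]
  ring_nf

theorem integral_cosh_half_mul_exp (ε : ℝ) :
    ∫ t : ℝ, Real.cosh (t / 2) * Real.exp (-ε * (Real.cosh t - 1)) = 2 * √(π / (2 * ε)) := by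
  rw [← integral_gaussian,
    ← integral_cosh_half_mul_comp_sinh_half (fun u => Real.exp (-(2 * ε) * u ^ 2)),
    ← integral_const_mul]
  congr 1 with t
  rw [Real.cosh_sub_one_eq_two_mul_sinh_half_sq t]
  ring_nf

theorem integrable_sinh_half_mul_exp {ε : ℝ} (hε : 0 < ε) :
    Integrable fun t : ℝ => Real.sinh (t / 2) * Real.exp (-ε * (Real.cosh t - 1)) := by
  refine (integrable_cosh_half_mul_exp hε).mono
    (Continuous.aestronglyMeasurable (by fun_prop)) (.of_forall fun t => ?_)
  simp only [norm_mul, Real.norm_eq_abs]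
  refine mul_le_mul_of_nonneg_right ?_ (abs_nonneg _)
  rw [Real.abs_sinh, abs_of_pos (Real.cosh_pos _), ← Real.cosh_abs (t / 2)]
  exact (Real.sinh_lt_cosh _).le

theorem integral_sinh_half_mul_exp (ε : ℝ) :
    ∫ t : ℝ, Real.sinh (t / 2) * Real.exp (-ε * (Real.cosh t - 1)) = 0 := by
  have h := integral_neg_eq_self
    (fun t : ℝ => Real.sinh (t / 2) * Real.exp (-ε * (Real.cosh t - 1))) volume
  simp only [neg_div, Real.sinh_neg, Real.cosh_neg, neg_mul _ (Real.exp _), integral_neg] at h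
  linarith

/-- For every `ε > 0`,
`(1/√(2π)) ∫_ℝ e^{t/2} e^{-ε(cosh t - 1)} dt = 1/√ε`. -/
theorem pinned_single_site_integral (ε : ℝ) (hε : 0 < ε) :
    (Real.sqrt (2 * π))⁻¹ *
      ∫ t : ℝ, Real.exp (t / 2) * Real.exp (-ε * (Real.cosh t - 1))
      = 1 / Real.sqrt ε := by
  simp_rw [← Real.cosh_add_sinh (_ / 2), add_mul]
  rw [integral_add (integrable_cosh_half_mul_exp hε) (integrable_sinh_half_mul_exp hε),
    integral_cosh_half_mul_exp, integral_sinh_half_mul_exp, add_zero,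
    Real.sqrt_div pi_pos.le, Real.sqrt_mul two_pos.le, Real.sqrt_mul two_pos.le]
  have hπ : √π ≠ 0 := (Real.sqrt_pos.2 pi_pos).ne'
  have h : √ε ≠ 0 := (Real.sqrt_pos.2 hε).ne'
  field_simp
  norm_num
end
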